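/- Entanglement-assisted quantum Singleton bound, case 2(d−1) < n. Let q ≥ 2, K ≥ 1, d ≥ 2, and 2(d−1) < n. Let ψ be a pure quantum state on R ⊗ A_f ⊗ X_1 ⊗ … ⊗ X_n ⊗ B_in, where R has dimension K, each X_i has dimension q, and the marginal of ψ on R is the maximally mixed state (1/K)·Id_K. Suppose that for every partition {1,…,n} = I ∪ J with |I| = n−d+1 and |J| = d−1, S(X_I B_in)_ψ = S(R)_ψ + S(A_f)_ψ + S(X_J)_ψ. Then log K ≤ (n−2d+2)·σ̄ + ℓ ≤ (n−2d+2)·log q + ℓ, where σ̄ := (1/(d−1))·E_{|J|=d−1} S(X_J)_ψ and ℓ := S(B_in)_ψ − S(A_f)_ψ. -/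

import Mathlib

open scoped BigOperators ComplexOrder

/-- Von Neumann entropy of a matrix: `-∑ λ_j log λ_j` over the eigenvalues,
if the matrix is Hermitian (else junk value 0). Natural logarithm,
with the convention `0 * log 0 = 0` (automatic since `Real.log 0 = 0`). -/
noncomputable def vnEntropy {m : Type*} [Fintype m] [DecidableEq m]
    (ρ : Matrix m m ℂ) : ℝ :=
  if h : ρ.IsHermitian then
    -∑ j, h.eigenvalues j * Real.log (h.eigenvalues j)
  else 0

/-- Marginal (partial trace) of a state on the composite system
`⨂_{i : ι} X_i` (with `X_i = ℂ^{dim i}`), keeping the factors in `S`. -/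
noncomputable def marginal {ι : Type*} [Fintype ι] [DecidableEq ι]
    {dim : ι → ℕ}
    (ρ : Matrix ((i : ι) → Fin (dim i)) ((i : ι) → Fin (dim i)) ℂ)
    (S : Finset ι) :
    Matrix ((i : {j : ι // j ∈ S}) → Fin (dim i.1))
           ((i : {j : ι // j ∈ S}) → Fin (dim i.1)) ℂ :=
  fun x y =>
    ∑ z : (i : {j : ι // j ∉ S}) → Fin (dim i.1),
      ρ (fun i => if h : i ∈ S then x ⟨i, h⟩ else z ⟨i, h⟩)
        (fun i => if h : i ∈ S then y ⟨i, h⟩ else z ⟨i, h⟩)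

/-- Entropy of the marginal of `ρ` on the factors in `S`. -/
noncomputable def mEnt {ι : Type*} [Fintype ι] [DecidableEq ι]
    {dim : ι → ℕ}
    (ρ : Matrix ((i : ι) → Fin (dim i)) ((i : ι) → Fin (dim i)) ℂ)
    (S : Finset ι) : ℝ :=
  vnEntropy (marginal ρ S)


open Matrix in
/-- Unitary diagonalization data. -/
structure UDiag {m : Type*} [Fintype m] [DecidableEq m]
    (ρ U : Matrix m m ℂ) (a : m → ℝ) : Prop where
  h1 : Uᴴ * U = 1
  h2 : U * Uᴴ = 1
  h : ρ = U * diagonal (fun i => (a i : ℂ)) * Uᴴ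

open Matrix in
lemma uDiag_of_herm {m : Type*} [Fintype m] [DecidableEq m]
    {ρ : Matrix m m ℂ} (hρ : ρ.IsHermitian) :
    UDiag ρ (hρ.eigenvectorUnitary : Matrix m m ℂ) hρ.eigenvalues where
  h1 := Unitary.coe_star_mul_self hρ.eigenvectorUnitary
  h2 := Unitary.coe_mul_star_self hρ.eigenvectorUnitary
  h := by
    conv_lhs => rw [hρ.spectral_theorem, Unitary.conjStarAlgAut_apply]
    rfl

open Matrix in
/-- quadratic form in the variational formula -/
noncomputable def qf {m : Type*} [Fintype m] (ρ σ : Matrix m m ℂ) (T : ℝ) (X : Matrix m m ℂ) : ℝ :=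
  (2 * trace (Xᴴ * ρ) - trace (Xᴴ * σ * X) - T * trace (X * ρ * Xᴴ)).re

open Matrix in
lemma trace_diag_aux {m : Type*} [Fintype m] [DecidableEq m] (Y : Matrix m m ℂ) (b : m → ℝ) :
    trace (Yᴴ * diagonal (fun j => (b j : ℂ)) * Y)
      = ((∑ j, ∑ i, b j * Complex.normSq (Y j i) : ℝ) : ℂ) := by
  simp only [trace, diag]
  simp only [mul_apply (M := Yᴴ * _), mul_diagonal, conjTranspose_apply]
  rw [Finset.sum_comm]
  push_cast
  refine Finset.sum_congr rfl fun j _ => Finset.sum_congr rfl fun i _ => ?_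
  rw [Complex.normSq_eq_conj_mul_self]
  simp
  ring

open Matrix in
lemma trace_diag_aux2 {m : Type*} [Fintype m] [DecidableEq m] (Y : Matrix m m ℂ) (b : m → ℝ) :
    trace (Y * diagonal (fun j => (b j : ℂ)) * Yᴴ)
      = ((∑ j, ∑ i, b i * Complex.normSq (Y j i) : ℝ) : ℂ) := by
  simp only [trace, diag]
  simp only [mul_apply (M := Y * _), mul_diagonal, conjTranspose_apply]
  push_cast
  refine Finset.sum_congr rfl fun j _ => Finset.sum_congr rfl fun i _ => ?_
  rw [Complex.normSq_eq_conj_mul_self]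
  simp
  ring

open Matrix in
lemma qf_eq {m : Type*} [Fintype m] [DecidableEq m] {ρ σ U V : Matrix m m ℂ} {a b : m → ℝ}
    (hρ : UDiag ρ U a) (hσ : UDiag σ V b) (T : ℝ) (Y : Matrix m m ℂ) :
    qf ρ σ T (V * Y * Uᴴ) = ∑ j, ∑ i, (2 * a i * (star (Y j i) * (Vᴴ * U) j i).re
      - (b j + T * a i) * Complex.normSq (Y j i)) := by
  have e1 : trace ((V * Y * Uᴴ)ᴴ * ρ)
      = trace (Yᴴ * (Vᴴ * U) * diagonal (fun i => (a i : ℂ))) := by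
    rw [hρ.h]
    calc _ = trace (U * (Yᴴ * (Vᴴ * U) * diagonal (fun i => (a i : ℂ)) * Uᴴ)) := by
            simp [conjTranspose_mul, Matrix.mul_assoc]
      _ = _ := by rw [trace_mul_comm, Matrix.mul_assoc, hρ.h1, Matrix.mul_one]
  have e2 : trace ((V * Y * Uᴴ)ᴴ * σ * (V * Y * Uᴴ))
      = trace (Yᴴ * diagonal (fun i => (b i : ℂ)) * Y) := by
    rw [hσ.h]
    calc _ = trace (U * (Yᴴ * (Vᴴ * V) * diagonal (fun i => (b i : ℂ)) * (Vᴴ * V) * Y * Uᴴ)) := by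
            simp [conjTranspose_mul, Matrix.mul_assoc]
      _ = _ := by
        rw [trace_mul_comm, Matrix.mul_assoc, hρ.h1, hσ.h1, Matrix.mul_one, Matrix.mul_one,
          Matrix.mul_one]
  have e3 : trace ((V * Y * Uᴴ) * ρ * (V * Y * Uᴴ)ᴴ)
      = trace (Y * diagonal (fun i => (a i : ℂ)) * Yᴴ) := by
    rw [hρ.h]
    calc _ = trace (V * (Y * (Uᴴ * U) * diagonal (fun i => (a i : ℂ)) * (Uᴴ * U) * Yᴴ * Vᴴ)) := by
            simp [conjTranspose_mul, Matrix.mul_assoc]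
      _ = _ := by
        rw [trace_mul_comm, Matrix.mul_assoc, hσ.h1, hρ.h1, Matrix.mul_one, Matrix.mul_one,
          Matrix.mul_one]
  have e1' : trace (Yᴴ * (Vᴴ * U) * diagonal (fun i => (a i : ℂ)))
      = ∑ j, ∑ i, (a i : ℂ) * (star (Y j i) * (Vᴴ * U) j i) := by
    generalize Vᴴ * U = W
    simp only [trace, diag, mul_diagonal]
    rw [Finset.sum_comm]
    refine Finset.sum_congr rfl fun i _ => ?_
    rw [mul_apply, Finset.sum_mul]
    refine Finset.sum_congr rfl fun j _ => ?_
    simp only [conjTranspose_apply]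
    ring
  unfold qf
  rw [e1, e2, e3, e1', trace_diag_aux, trace_diag_aux2]
  simp only [Complex.sub_re, Complex.ofReal_re, Complex.re_ofReal_mul]
  rw [show (2:ℂ) = ((2:ℝ):ℂ) by simp, Complex.re_ofReal_mul, Complex.re_sum]
  simp only [Complex.re_sum, Complex.re_ofReal_mul, Finset.mul_sum, ← Finset.sum_sub_distrib]
  refine Finset.sum_congr rfl fun j _ => Finset.sum_congr rfl fun i _ => ?_
  ring

/-- transition weights -/
noncomputable def wgt {m : Type*} [Fintype m] (U V : Matrix m m ℂ) (j i : m) : ℝ :=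
  Complex.normSq ((V.conjTranspose * U) j i)

noncomputable def Fs {m : Type*} [Fintype m] (U V : Matrix m m ℂ) (a b : m → ℝ) (T : ℝ) : ℝ :=
  ∑ j, ∑ i, wgt U V j i * (a i ^ 2 / (b j + T * a i))

open Matrix in
lemma qf_le {m : Type*} [Fintype m] [DecidableEq m] {ρ σ U V : Matrix m m ℂ} {a b : m → ℝ}
    (hρ : UDiag ρ U a) (hσ : UDiag σ V b) (ha : ∀ i, 0 ≤ a i) (hb : ∀ i, 0 < b i)
    {T : ℝ} (hT : 0 ≤ T) (X : Matrix m m ℂ) :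
    qf ρ σ T X ≤ Fs U V a b T := by
  have hX : X = V * (Vᴴ * X * U) * Uᴴ := by
    calc X = (V * Vᴴ) * X * (U * Uᴴ) := by rw [hρ.h2, hσ.h2]; simp
      _ = _ := by simp [Matrix.mul_assoc]
  rw [hX, qf_eq hρ hσ]
  refine Finset.sum_le_sum fun j _ => Finset.sum_le_sum fun i _ => ?_
  unfold wgt
  generalize (Vᴴ * X * U) j i = y
  generalize (Vᴴ * U) j i = w
  have hc : 0 < b j + T * a i := add_pos_of_pos_of_nonneg (hb j) (mul_nonneg hT (ha i))
  generalize b j + T * a i = c at hc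
  rw [← mul_div_assoc, le_div_iff₀ hc]
  simp only [Complex.normSq_apply, Complex.mul_re, RCLike.star_def, Complex.conj_re, Complex.conj_im]
  nlinarith [sq_nonneg (a i * w.re - c * y.re), sq_nonneg (a i * w.im - c * y.im)]

open Matrix in
lemma qf_attain {m : Type*} [Fintype m] [DecidableEq m] {ρ σ U V : Matrix m m ℂ} {a b : m → ℝ}
    (hρ : UDiag ρ U a) (hσ : UDiag σ V b) (ha : ∀ i, 0 ≤ a i) (hb : ∀ i, 0 < b i)
    {T : ℝ} (hT : 0 ≤ T) : ∃ X : Matrix m m ℂ, qf ρ σ T X = Fs U V a b T := by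
  refine ⟨V * Matrix.of (fun j i => ((a i / (b j + T * a i) : ℝ) : ℂ) * (Vᴴ * U) j i) * Uᴴ, ?_⟩
  rw [qf_eq hρ hσ]
  refine Finset.sum_congr rfl fun j _ => Finset.sum_congr rfl fun i _ => ?_
  unfold wgt
  rw [Matrix.of_apply]
  generalize (Vᴴ * U) j i = w
  have hc : 0 < b j + T * a i := add_pos_of_pos_of_nonneg (hb j) (mul_nonneg hT (ha i))
  generalize b j + T * a i = c at hc
  simp only [Complex.normSq_apply, Complex.mul_re, RCLike.star_def, Complex.conj_re, Complex.conj_im,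
    Complex.mul_im, Complex.ofReal_re, Complex.ofReal_im]
  field_simp
  ring

/-- partial trace along an equivalence -/
noncomputable def ptr {m k g : Type*} [Fintype g] (e : m ≃ k × g) (ρ : Matrix m m ℂ) :
    Matrix k k ℂ :=
  fun x y => ∑ c, ρ (e.symm (x, c)) (e.symm (y, c))

open Matrix in
lemma sum_equiv_prod {m k g M : Type*} [Fintype m] [Fintype k] [Fintype g] [AddCommMonoid M]
    (e : m ≃ k × g) (f : m → M) : ∑ x, f x = ∑ y, ∑ c, f (e.symm (y, c)) := by
  rw [← Fintype.sum_prod_type' (f := fun y c => f (e.symm (y, c)))]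
  exact (Equiv.sum_comp e.symm f).symm

/-- `X ⊗ 1` along an equivalence -/
noncomputable def lft {m k g : Type*} [DecidableEq g] (e : m ≃ k × g) (X : Matrix k k ℂ) :
    Matrix m m ℂ :=
  Matrix.of fun x y => if (e x).2 = (e y).2 then X (e x).1 (e y).1 else 0

lemma lft_apply {m k g : Type*} [DecidableEq g] (e : m ≃ k × g) (X : Matrix k k ℂ) (x y : m) :
    lft e X x y = if (e x).2 = (e y).2 then X (e x).1 (e y).1 else 0 := rfl

open Matrix in
lemma trace_lift {m k g : Type*} [Fintype m] [Fintype k] [Fintype g] [DecidableEq g]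
    (e : m ≃ k × g) (ρ : Matrix m m ℂ) (X : Matrix k k ℂ) :
    trace (lft e X * ρ)
      = trace (X * ptr e ρ) := by
  simp only [trace, diag, mul_apply, ptr, lft_apply]
  rw [sum_equiv_prod e]
  refine Finset.sum_congr rfl fun x _ => ?_
  simp only [sum_equiv_prod e, Equiv.apply_symm_apply, ite_mul, zero_mul, Finset.sum_ite_eq,
    Finset.mem_univ, if_true, Finset.mul_sum]
  rw [Finset.sum_comm]

open Matrix in
lemma qf_ptr {m k g : Type*} [Fintype m] [Fintype k] [Fintype g] [DecidableEq g]
    (e : m ≃ k × g) (ρ σ : Matrix m m ℂ) (T : ℝ) (X : Matrix k k ℂ) :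
    qf (ptr e ρ) (ptr e σ) T X =
      qf ρ σ T (lft e X) := by
  have hH : ∀ X, (lft e X)ᴴ = lft e Xᴴ := by
    intro X
    ext x y
    simp only [lft_apply, conjTranspose_apply]
    by_cases h : (e x).2 = (e y).2
    · simp [h]
    · have h' : ¬ (e y).2 = (e x).2 := fun h' => h h'.symm
      simp [h, h']
  have hM : ∀ X Y, lft e X * lft e Y = lft e (X * Y) := by
    intro X Y
    ext x y
    simp only [lft_apply, mul_apply]
    rw [sum_equiv_prod e]
    by_cases h : (e x).2 = (e y).2
    · simp [h]
    · simp [h]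
  have ht : ∀ X ρ, trace (lft e X * ρ) = trace (X * ptr e ρ) := fun X ρ => trace_lift e ρ X
  unfold qf
  rw [hH, ht, trace_mul_comm (lft e Xᴴ * σ), ← Matrix.mul_assoc, hM, ht,
    trace_mul_comm (lft e X * ρ), ← Matrix.mul_assoc, hM, ht, trace_mul_comm (Xᴴ * _),
    ← Matrix.mul_assoc, trace_mul_comm (X * _) Xᴴ, ← Matrix.mul_assoc]

open Matrix in
lemma Fs_mono {m k g : Type*} [Fintype m] [Fintype k] [Fintype g] [DecidableEq g]
    [DecidableEq m] [DecidableEq k]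
    (e : m ≃ k × g) {ρ σ U V : Matrix m m ℂ} {a b : m → ℝ}
    (hρ : UDiag ρ U a) (hσ : UDiag σ V b) (ha : ∀ i, 0 ≤ a i) (hb : ∀ i, 0 < b i)
    {U' V' : Matrix k k ℂ} {a' b' : k → ℝ}
    (hρ' : UDiag (ptr e ρ) U' a') (hσ' : UDiag (ptr e σ) V' b')
    (ha' : ∀ i, 0 ≤ a' i) (hb' : ∀ i, 0 < b' i)
    {T : ℝ} (hT : 0 ≤ T) : Fs U' V' a' b' T ≤ Fs U V a b T := by
  obtain ⟨X, hX⟩ := qf_attain hρ' hσ' ha' hb' hT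
  rw [← hX, qf_ptr]
  exact qf_le hρ hσ ha hb hT _

noncomputable def Hs {m : Type*} [Fintype m] (U V : Matrix m m ℂ) (a b : m → ℝ) (T : ℝ) : ℝ :=
  ∑ j, ∑ i, wgt U V j i * (a i * Real.log (b j + T * a i))

lemma Hs_deriv {m : Type*} [Fintype m] (U V : Matrix m m ℂ) {a b : m → ℝ}
    (ha : ∀ i, 0 ≤ a i) (hb : ∀ i, 0 < b i) {T : ℝ} (hT : 0 ≤ T) :
    HasDerivAt (Hs U V a b) (Fs U V a b T) T := by
  unfold Hs Fs
  refine HasDerivAt.fun_sum fun j _ => HasDerivAt.fun_sum fun i _ => ?_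
  have hc : 0 < b j + T * a i := add_pos_of_pos_of_nonneg (hb j) (mul_nonneg hT (ha i))
  have h1 : HasDerivAt (fun T : ℝ => b j + T * a i) (a i) T := by
    simpa using ((hasDerivAt_id T).mul_const (a i)).const_add (b j)
  have h2 := ((h1.log hc.ne').const_mul (a i)).const_mul (wgt U V j i)
  rw [pow_two, mul_div_assoc]
  exact h2

open Matrix in
lemma wgt_sum {m : Type*} [Fintype m] [DecidableEq m] {U V : Matrix m m ℂ}
    (hU : Uᴴ * U = 1) (hV : V * Vᴴ = 1) (i : m) : ∑ j, wgt U V j i = 1 := by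
  have h : (Vᴴ * U)ᴴ * (Vᴴ * U) = 1 := by
    calc _ = Uᴴ * (V * Vᴴ) * U := by simp [conjTranspose_mul, Matrix.mul_assoc]
      _ = 1 := by rw [hV, Matrix.mul_one, hU]
  have h2 := congrFun (congrFun h i) i
  rw [mul_apply] at h2
  simp only [conjTranspose_apply, one_apply_eq] at h2
  have : ((∑ j, wgt U V j i : ℝ) : ℂ) = 1 := by
    rw [← h2]
    push_cast
    refine Finset.sum_congr rfl fun j _ => ?_
    rw [wgt, Complex.normSq_eq_conj_mul_self]
    rfl
  exact_mod_cast this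

open Matrix Filter Topology in
lemma Hs_lim {m : Type*} [Fintype m] [DecidableEq m] {U V : Matrix m m ℂ} {a b : m → ℝ}
    (hU : Uᴴ * U = 1) (hV : V * Vᴴ = 1) (ha : ∀ i, 0 ≤ a i) (hb : ∀ i, 0 < b i) :
    Tendsto (fun T => Hs U V a b T - Real.log T * ∑ i, a i) atTop
      (𝓝 (∑ i, a i * Real.log (a i))) := by
  have e1 : ∀ f : m → ℝ, ∑ i, f i = ∑ j, ∑ i, wgt U V j i * f i := by
    intro f
    rw [Finset.sum_comm]
    refine Finset.sum_congr rfl fun i _ => ?_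
    rw [← Finset.sum_mul, wgt_sum hU hV, one_mul]
  rw [e1 (fun i => a i * Real.log (a i))]
  have : (fun T => Hs U V a b T - Real.log T * ∑ i, a i) =
      fun T => ∑ j, ∑ i, wgt U V j i * (a i * (Real.log (b j + T * a i) - Real.log T)) := by
    ext T
    rw [e1 a, Hs, Finset.mul_sum, ← Finset.sum_sub_distrib]
    refine Finset.sum_congr rfl fun j _ => ?_
    rw [Finset.mul_sum, ← Finset.sum_sub_distrib]
    refine Finset.sum_congr rfl fun i _ => ?_
    ring
  rw [this]
  refine tendsto_finsetSum _ fun j _ => tendsto_finsetSum _ fun i _ => ?_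
  refine Tendsto.const_mul _ ?_
  rcases (ha i).eq_or_lt with h0 | h0
  · simp [← h0]
  refine Tendsto.const_mul _ ?_
  have h3 : Tendsto (fun T : ℝ => b j / T + a i) atTop (𝓝 (0 + a i)) :=
    (tendsto_const_nhds.div_atTop tendsto_id).add tendsto_const_nhds
  rw [zero_add] at h3
  have h4 := h3.log h0.ne'
  refine h4.congr' ?_
  filter_upwards [eventually_gt_atTop 0] with T hT
  rw [← Real.log_div (by have := hb j; positivity) hT.ne']
  congr 1
  field_simp

open Matrix in
lemma trace_ptr {m k g : Type*} [Fintype m] [Fintype k] [Fintype g]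
    (e : m ≃ k × g) (ρ : Matrix m m ℂ) : trace (ptr e ρ) = trace ρ := by
  simp only [trace, diag, ptr]
  rw [sum_equiv_prod e]

open Matrix in
lemma UDiag.trace_eq {m : Type*} [Fintype m] [DecidableEq m]
    {ρ U : Matrix m m ℂ} {a : m → ℝ} (h : UDiag ρ U a) : trace ρ = ((∑ i, a i : ℝ) : ℂ) := by
  rw [h.h, Matrix.mul_assoc, trace_mul_comm, Matrix.mul_assoc, h.h1, Matrix.mul_one, trace_diagonal]
  push_cast
  rfl

open Matrix Filter Topology in
/-- monotonicity of relative entropy under partial trace -/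
lemma relent_mono {m k g : Type*} [Fintype m] [Fintype k] [Fintype g] [DecidableEq g]
    [DecidableEq m] [DecidableEq k]
    (e : m ≃ k × g) {ρ σ U V : Matrix m m ℂ} {a b : m → ℝ}
    (hρ : UDiag ρ U a) (hσ : UDiag σ V b) (ha : ∀ i, 0 ≤ a i) (hb : ∀ i, 0 < b i)
    {U' V' : Matrix k k ℂ} {a' b' : k → ℝ}
    (hρ' : UDiag (ptr e ρ) U' a') (hσ' : UDiag (ptr e σ) V' b')
    (ha' : ∀ i, 0 ≤ a' i) (hb' : ∀ i, 0 < b' i) :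
    Hs U V a b 0 - Hs U' V' a' b' 0
      ≤ ∑ i, a i * Real.log (a i) - ∑ i, a' i * Real.log (a' i) := by
  have hs : ∑ i, a i = ∑ i, a' i := by
    have h1 := hρ.trace_eq
    have h2 := hρ'.trace_eq
    rw [trace_ptr, h1] at h2
    exact_mod_cast h2
  have hd : ∀ T : ℝ, 0 ≤ T → HasDerivAt (fun T => Hs U V a b T - Hs U' V' a' b' T)
      (Fs U V a b T - Fs U' V' a' b' T) T := fun T hT =>
    (Hs_deriv U V ha hb hT).sub (Hs_deriv U' V' ha' hb' hT)
  have hmono : MonotoneOn (fun T => Hs U V a b T - Hs U' V' a' b' T) (Set.Ici 0) := by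
    refine monotoneOn_of_deriv_nonneg (convex_Ici 0)
      (fun T hT => (hd T hT).continuousAt.continuousWithinAt) ?_ ?_
    · intro T hT
      rw [interior_Ici] at hT
      exact (hd T (le_of_lt hT)).differentiableAt.differentiableWithinAt
    · intro T hT
      rw [interior_Ici] at hT
      rw [(hd T (le_of_lt hT)).deriv, sub_nonneg]
      exact Fs_mono e hρ hσ ha hb hρ' hσ' ha' hb' (le_of_lt hT)
  have hl := (Hs_lim hρ.h1 hσ.h2 ha hb).sub (Hs_lim hρ'.h1 hσ'.h2 ha' hb')
  refine ge_of_tendsto hl ?_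
  filter_upwards [eventually_ge_atTop 0] with T hT
  have := hmono (Set.mem_Ici.2 le_rfl) (Set.mem_Ici.2 hT) hT
  simp only at this
  rw [hs]
  linarith

open Matrix in
lemma Hs_zero {m : Type*} [Fintype m] [DecidableEq m] {ρ U V : Matrix m m ℂ} {a : m → ℝ} (b : m → ℝ)
    (hρ : UDiag ρ U a) :
    Hs U V a b 0 = ∑ j, ((Vᴴ * ρ * V) j j).re * Real.log (b j) := by
  unfold Hs
  refine Finset.sum_congr rfl fun j _ => ?_
  have : Vᴴ * ρ * V = (Vᴴ * U) * diagonal (fun i => (a i : ℂ)) * (Vᴴ * U)ᴴ := by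
    rw [hρ.h]; simp [conjTranspose_mul, Matrix.mul_assoc]
  rw [this, mul_apply, Complex.re_sum, Finset.sum_mul]
  refine Finset.sum_congr rfl fun i _ => ?_
  rw [wgt, mul_diagonal, conjTranspose_apply]
  generalize (Vᴴ * U) j i = w
  simp [Complex.normSq_apply]
  ring

open Matrix Kronecker in
lemma uDiag_kron {α β : Type*} [Fintype α] [Fintype β] [DecidableEq α] [DecidableEq β]
    {τ V : Matrix β β ℂ} {c : β → ℝ} (h : UDiag τ V c) (ε : ℝ) :
    UDiag ((1 : Matrix α α ℂ) ⊗ₖ (τ + (ε : ℂ) • 1)) ((1 : Matrix α α ℂ) ⊗ₖ V)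
      (fun p => c p.2 + ε) where
  h1 := by rw [conjTranspose_kronecker, ← mul_kronecker_mul, h.h1]; simp
  h2 := by rw [conjTranspose_kronecker, ← mul_kronecker_mul, h.h2]; simp
  h := by
    have e1 : diagonal (fun p : α × β => ((c p.2 + ε : ℝ) : ℂ))
        = (1 : Matrix α α ℂ) ⊗ₖ (diagonal (fun i => (c i : ℂ)) + (ε : ℂ) • 1) := by
      rw [smul_one_eq_diagonal, diagonal_add, ← diagonal_one, diagonal_kronecker_diagonal]
      simp
    rw [e1, conjTranspose_kronecker, ← mul_kronecker_mul, ← mul_kronecker_mul]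
    congr 1
    · simp
    · rw [Matrix.mul_add, Matrix.add_mul, ← h.h]
      simp [h.h2]

open Matrix Kronecker in
lemma Hs_kron {α β : Type*} [Fintype α] [Fintype β] [DecidableEq α] [DecidableEq β]
    {ρ U : Matrix (α × β) (α × β) ℂ} {a : α × β → ℝ} (hρ : UDiag ρ U a)
    {V : Matrix β β ℂ} {c : β → ℝ} (h : UDiag (ptr (Equiv.prodComm α β) ρ) V c) (ε : ℝ) :
    Hs U ((1 : Matrix α α ℂ) ⊗ₖ V) a (fun p => c p.2 + ε) 0 = ∑ k, c k * Real.log (c k + ε) := by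
  rw [Hs_zero _ hρ, Fintype.sum_prod_type, Finset.sum_comm]
  refine Finset.sum_congr rfl fun k _ => ?_
  simp only
  rw [← Finset.sum_mul]
  congr 1
  have e1 : Vᴴ * ptr (Equiv.prodComm α β) ρ * V = diagonal (fun i => (c i : ℂ)) := by
    calc _ = (Vᴴ * V) * diagonal (fun i => (c i : ℂ)) * (Vᴴ * V) := by
            rw [h.h]; simp [Matrix.mul_assoc]
      _ = _ := by rw [h.h1]; simp
  have e2 := congrFun (congrFun e1 k) k
  rw [diagonal_apply_eq] at e2
  rw [← Complex.ofReal_re (c k), ← e2, ← Complex.re_sum]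
  congr 1
  simp only [mul_apply, conjTranspose_kronecker, kroneckerMap_apply, Fintype.sum_prod_type, ptr,
    conjTranspose_one, one_apply, ite_mul, mul_ite, zero_mul, mul_zero, one_mul,
    Finset.sum_ite_irrel, Finset.sum_const_zero, Finset.sum_ite_eq, Finset.sum_ite_eq',
    Finset.mem_univ, if_true, Finset.mul_sum, Finset.sum_mul, Equiv.prodComm_symm,
    Equiv.prodComm_apply, Prod.swap_prod_mk]
  rw [Finset.sum_comm]
  refine Finset.sum_congr rfl fun y _ => ?_
  rw [Finset.sum_comm]

open Matrix in
lemma ptr_posSemidef {m k g : Type*} [Fintype g]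
    (e : m ≃ k × g) {ρ : Matrix m m ℂ} (h : ρ.PosSemidef) : (ptr e ρ).PosSemidef := by
  have : ptr e ρ = ∑ c, ρ.submatrix (fun x => e.symm (x, c)) (fun x => e.symm (x, c)) := by
    ext x y
    simp [ptr, Matrix.sum_apply]
  rw [this]
  exact posSemidef_sum _ fun c _ => h.submatrix _

lemma vnEntropy_herm {m : Type*} [Fintype m] [DecidableEq m] {ρ : Matrix m m ℂ}
    (h : ρ.IsHermitian) :
    vnEntropy ρ = -∑ j, h.eigenvalues j * Real.log (h.eigenvalues j) := by
  rw [vnEntropy, dif_pos h]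

open Filter Topology in
lemma sum_log_lim {m : Type*} [Fintype m] (c : m → ℝ) (t : ℝ) :
    Tendsto (fun ε : ℝ => ∑ k, c k * Real.log (c k + ε * t)) (𝓝[>] 0)
      (𝓝 (∑ k, c k * Real.log (c k))) := by
  refine tendsto_finsetSum _ fun k _ => ?_
  by_cases h : c k = 0
  · simp [h]
  refine Tendsto.const_mul _ ?_
  have h1 : Tendsto (fun ε : ℝ => c k + ε * t) (𝓝 0) (𝓝 (c k + 0 * t)) :=
    (Continuous.tendsto (by fun_prop) 0)
  rw [zero_mul, add_zero] at h1
  exact (h1.log h).mono_left nhdsWithin_le_nhds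

open Matrix Kronecker Filter Topology in
/-- strong subadditivity -/
lemma ssa_prod {α β γ : Type*} [Fintype α] [Fintype β] [Fintype γ] [DecidableEq α] [DecidableEq β]
    [DecidableEq γ] [Nonempty γ] {ρ : Matrix (α × β × γ) (α × β × γ) ℂ} (hρ : ρ.PosSemidef) :
    vnEntropy ρ + vnEntropy (ptr (Equiv.refl (β × γ)) (ptr (Equiv.prodComm α (β × γ)) ρ)) ≤
      vnEntropy (ptr (Equiv.prodAssoc α β γ).symm ρ) +
      vnEntropy (ptr (Equiv.prodComm α (β × γ)) ρ) := by
  have hBC := ptr_posSemidef (Equiv.prodComm α (β × γ)) hρ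
  have hB := ptr_posSemidef (Equiv.refl (β × γ)) hBC
  have hAB := ptr_posSemidef (Equiv.prodAssoc α β γ).symm hρ
  have hcard : (0 : ℝ) < Fintype.card γ := by exact_mod_cast Fintype.card_pos
  have hBeq : ptr (Equiv.prodComm α β) (ptr (Equiv.prodAssoc α β γ).symm ρ)
      = ptr (Equiv.refl (β × γ)) (ptr (Equiv.prodComm α (β × γ)) ρ) := by
    ext x y
    simp only [ptr]
    rw [Finset.sum_comm]
    rfl
  have dρ := uDiag_of_herm hρ.1
  have dBC := uDiag_of_herm hBC.1
  have dB := uDiag_of_herm hB.1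
  have dB2 : UDiag (ptr (Equiv.prodComm α β) (ptr (Equiv.prodAssoc α β γ).symm ρ))
      (hB.1.eigenvectorUnitary : Matrix β β ℂ) hB.1.eigenvalues := ⟨dB.h1, dB.h2, hBeq.trans dB.h⟩
  have dAB := uDiag_of_herm hAB.1
  rw [vnEntropy_herm hρ.1, vnEntropy_herm hBC.1, vnEntropy_herm hB.1, vnEntropy_herm hAB.1]
  have key : ∀ ε : ℝ, 0 < ε →
      ∑ k, hBC.1.eigenvalues k * Real.log (hBC.1.eigenvalues k + ε * 1)
      - ∑ k, hB.1.eigenvalues k * Real.log (hB.1.eigenvalues k + ε * Fintype.card γ)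
      ≤ ∑ k, hρ.1.eigenvalues k * Real.log (hρ.1.eigenvalues k)
        - ∑ k, hAB.1.eigenvalues k * Real.log (hAB.1.eigenvalues k) := by
    intro ε hε
    have hσ := uDiag_kron (α := α) dBC (ε * 1)
    have hσ' := uDiag_kron (α := α) dB (ε * Fintype.card γ)
    rw [← Hs_kron dρ dBC (ε * 1), ← Hs_kron dAB dB2 (ε * Fintype.card γ)]
    refine relent_mono (Equiv.prodAssoc α β γ).symm dρ hσ hρ.eigenvalues_nonneg ?_ dAB ?_
      hAB.eigenvalues_nonneg ?_
    · intro i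
      have := hBC.eigenvalues_nonneg i.2
      linarith
    · convert hσ' using 1
      ext ⟨x, y⟩ ⟨x', y'⟩
      generalize ptr (Equiv.prodComm α (β × γ)) ρ = τ
      change ∑ c, (1 : Matrix α α ℂ) x x' * (τ (y, c) (y', c) +
          (((ε * 1 : ℝ) : ℂ) • (1 : Matrix (β × γ) (β × γ) ℂ)) (y, c) (y', c))
        = (1 : Matrix α α ℂ) x x' * (∑ c, τ (y, c) (y', c) +
          (((ε * Fintype.card γ : ℝ) : ℂ) • (1 : Matrix β β ℂ)) y y')
      rw [← Finset.mul_sum, Finset.sum_add_distrib]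
      congr 2
      by_cases h : y = y'
      · simp [h, mul_comm]
      · simp [h]
    · intro i
      have := hB.eigenvalues_nonneg i.2
      have := mul_pos hε hcard
      linarith
  have hl := (sum_log_lim hBC.1.eigenvalues 1).sub (sum_log_lim hB.1.eigenvalues (Fintype.card γ))
  have := le_of_tendsto hl (by
    filter_upwards [self_mem_nhdsWithin] with ε hε
    exact key ε hε)
  linarith

open Matrix in
lemma vnEntropy_charpoly {m : Type*} [Fintype m] [DecidableEq m] {ρ : Matrix m m ℂ}
    (h : ρ.IsHermitian) :
    vnEntropy ρ = -(ρ.charpoly.roots.map (fun z => z.re * Real.log z.re)).sum := by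
  rw [vnEntropy_herm h, h.roots_charpoly_eq_eigenvalues, Multiset.map_map]
  rfl

open Matrix in
lemma vnEntropy_submatrix {m k : Type*} [Fintype m] [DecidableEq m] [Fintype k] [DecidableEq k]
    (e : k ≃ m) {ρ : Matrix m m ℂ} (h : ρ.IsHermitian) :
    vnEntropy (ρ.submatrix e e) = vnEntropy ρ := by
  rw [vnEntropy_charpoly h, vnEntropy_charpoly (h.submatrix e)]
  have := charpoly_reindex e.symm ρ
  rw [reindex_apply, Equiv.symm_symm] at this
  rw [this]

lemma vnEntropy_scalar {m : Type*} [Fintype m] [DecidableEq m] (c : ℝ) :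
    vnEntropy ((c : ℂ) • (1 : Matrix m m ℂ)) = -(Fintype.card m * (c * Real.log c)) := by
  have h : ((c : ℂ) • (1 : Matrix m m ℂ)).IsHermitian := by
    rw [Matrix.IsHermitian, Matrix.conjTranspose_smul]
    simp
  rw [vnEntropy_charpoly h, Matrix.smul_one_eq_diagonal, Matrix.charpoly_diagonal]
  simp [Polynomial.roots_pow, Multiset.map_nsmul, Multiset.sum_nsmul]

lemma vnEntropy_le_log {m : Type*} [Fintype m] [DecidableEq m] {ρ : Matrix m m ℂ}
    (h : ρ.PosSemidef) (ht : ρ.trace = 1) : vnEntropy ρ ≤ Real.log (Fintype.card m) := by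
  rw [vnEntropy_herm h.1]
  have hs : ∑ i, h.1.eigenvalues i = 1 := by
    have := h.1.trace_eq_sum_eigenvalues
    rw [ht] at this
    have h2 : ((∑ i, h.1.eigenvalues i : ℝ) : ℂ) = 1 := by rw [this]; push_cast; rfl
    exact_mod_cast h2
  have hne : Nonempty m := by
    by_contra hh
    rw [not_nonempty_iff] at hh
    simp at hs
  have hN : (0 : ℝ) < Fintype.card m := by exact_mod_cast Fintype.card_pos
  have key : ∀ i, -(h.1.eigenvalues i * Real.log (h.1.eigenvalues i)) ≤
      h.1.eigenvalues i * Real.log (Fintype.card m)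
        + ((Fintype.card m : ℝ)⁻¹ - h.1.eigenvalues i) := by
    intro i
    have hp := h.eigenvalues_nonneg i
    generalize h.1.eigenvalues i = p at hp
    rcases hp.eq_or_lt with h0 | h0
    · rw [← h0]; simp
    have h1 := Real.log_le_sub_one_of_pos (x := ((Fintype.card m : ℝ)⁻¹ / p)) (by positivity)
    rw [Real.log_div (by positivity) h0.ne', Real.log_inv] at h1
    have h2 := mul_le_mul_of_nonneg_left h1 hp
    have h3 : p * ((Fintype.card m : ℝ)⁻¹ / p - 1) = (Fintype.card m : ℝ)⁻¹ - p := by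
      field_simp
    rw [h3] at h2
    linarith
  rw [← Finset.sum_neg_distrib]
  refine (Finset.sum_le_sum fun i _ => key i).trans ?_
  rw [Finset.sum_add_distrib, ← Finset.sum_mul, Finset.sum_sub_distrib, hs]
  simp

/-- glue two partial assignments -/
def glue {ι : Type*} [DecidableEq ι] {dim : ι → ℕ} {S T W : Finset ι} (hW : S ∪ T = W)
    (x : (i : {j : ι // j ∈ S}) → Fin (dim i.1)) (t : (i : {j : ι // j ∈ T}) → Fin (dim i.1)) :
    (i : {j : ι // j ∈ W}) → Fin (dim i.1) :=
  fun i => if h : i.1 ∈ S then x ⟨i.1, h⟩ else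
    t ⟨i.1, (Finset.mem_union.1 (hW.symm ▸ i.2 : i.1 ∈ S ∪ T)).resolve_left h⟩

/-- gluing as an equivalence -/
def glueEquiv {ι : Type*} [DecidableEq ι] {dim : ι → ℕ} {S T W : Finset ι} (hW : S ∪ T = W)
    (hd : Disjoint S T) :
    ((i : {j : ι // j ∈ S}) → Fin (dim i.1)) × ((i : {j : ι // j ∈ T}) → Fin (dim i.1)) ≃
    ((i : {j : ι // j ∈ W}) → Fin (dim i.1)) where
  toFun p := glue hW p.1 p.2
  invFun u := (fun i => u ⟨i.1, by rw [← hW]; exact Finset.mem_union_left _ i.2⟩,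
    fun i => u ⟨i.1, by rw [← hW]; exact Finset.mem_union_right _ i.2⟩)
  left_inv p := by
    ext i
    · simp [glue, i.2]
    · have : i.1 ∉ S := Finset.disjoint_right.1 hd i.2
      simp [glue, this]
  right_inv u := by
    ext i
    simp only [glue]
    split_ifs <;> rfl

lemma marginal_glue {ι : Type*} [Fintype ι] [DecidableEq ι] {dim : ι → ℕ}
    (ρ : Matrix ((i : ι) → Fin (dim i)) ((i : ι) → Fin (dim i)) ℂ)
    {S T W : Finset ι} (hW : S ∪ T = W) (hd : Disjoint S T)
    (x y : (i : {j : ι // j ∈ S}) → Fin (dim i.1)) :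
    ∑ t, marginal ρ W (glue hW x t) (glue hW y t) = marginal ρ S x y := by
  unfold marginal
  rw [← Fintype.sum_prod_type' (f := fun (t : (i : {j : ι // j ∈ T}) → Fin (dim i.1))
    (z : (i : {j : ι // j ∉ W}) → Fin (dim i.1)) =>
      ρ (fun i => if h : i ∈ W then glue hW x t ⟨i, h⟩ else z ⟨i, h⟩)
        (fun i => if h : i ∈ W then glue hW y t ⟨i, h⟩ else z ⟨i, h⟩))]
  have hmem : ∀ i, i ∈ W ↔ i ∈ S ∨ i ∈ T := by intro i; rw [← hW, Finset.mem_union]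
  let E : (((i : {j : ι // j ∈ T}) → Fin (dim i.1)) × ((i : {j : ι // j ∉ W}) → Fin (dim i.1))) ≃
      ((i : {j : ι // j ∉ S}) → Fin (dim i.1)) :=
    { toFun := fun p i => if h : i.1 ∈ T then p.1 ⟨i.1, h⟩ else
        p.2 ⟨i.1, fun hw => ((hmem _).1 hw).elim i.2 h⟩
      invFun := fun u => (fun i => u ⟨i.1, Finset.disjoint_right.1 hd i.2⟩,
        fun i => u ⟨i.1, fun hs => i.2 ((hmem _).2 (Or.inl hs))⟩)
      left_inv := by
        intro p
        ext i
        · simp [i.2]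
        · have : i.1 ∉ T := fun hs => i.2 ((hmem _).2 (Or.inr hs))
          simp [this]
      right_inv := by
        intro u
        ext i
        simp only
        split_ifs <;> rfl }
  refine Fintype.sum_equiv E _ _ ?_
  rintro ⟨t, z⟩
  have key : ∀ x : (i : {j : ι // j ∈ S}) → Fin (dim i.1),
      (fun i => if h : i ∈ W then glue hW x t ⟨i, h⟩ else z ⟨i, h⟩ : (i : ι) → Fin (dim i))
        = (fun i => if h : i ∈ S then x ⟨i, h⟩ else E (t, z) ⟨i, h⟩) := by
    intro x
    ext i
    by_cases h1 : i ∈ S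
    · have h2 : i ∈ W := (hmem i).2 (Or.inl h1)
      simp [h1, h2, glue]
    · by_cases h3 : i ∈ T
      · have h2 : i ∈ W := (hmem i).2 (Or.inr h3)
        simp [h1, h2, h3, glue, E]
      · have h2 : i ∉ W := fun h => ((hmem i).1 h).elim h1 h3
        simp [h1, h2, h3, E]
  simp only [key]

lemma marginal_posSemidef {ι : Type*} [Fintype ι] [DecidableEq ι] {dim : ι → ℕ}
    {ρ : Matrix ((i : ι) → Fin (dim i)) ((i : ι) → Fin (dim i)) ℂ} (h : ρ.PosSemidef)
    (S : Finset ι) : (marginal ρ S).PosSemidef := by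
  have : marginal ρ S = ∑ z : (i : {j : ι // j ∉ S}) → Fin (dim i.1),
      ρ.submatrix (fun x i => if h : i ∈ S then x ⟨i, h⟩ else z ⟨i, h⟩)
        (fun x i => if h : i ∈ S then x ⟨i, h⟩ else z ⟨i, h⟩) := by
    ext x y
    simp [marginal, Matrix.sum_apply]
  rw [this]
  exact Matrix.posSemidef_sum _ fun c _ => h.submatrix _

lemma marginal_trace {ι : Type*} [Fintype ι] [DecidableEq ι] {dim : ι → ℕ}
    (ρ : Matrix ((i : ι) → Fin (dim i)) ((i : ι) → Fin (dim i)) ℂ)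
    (S : Finset ι) : (marginal ρ S).trace = ρ.trace := by
  simp only [Matrix.trace, Matrix.diag, marginal]
  rw [← Fintype.sum_prod_type' (f := fun (x : (i : {j : ι // j ∈ S}) → Fin (dim i.1))
    (z : (i : {j : ι // j ∉ S}) → Fin (dim i.1)) =>
      ρ (fun i => if h : i ∈ S then x ⟨i, h⟩ else z ⟨i, h⟩)
        (fun i => if h : i ∈ S then x ⟨i, h⟩ else z ⟨i, h⟩))]
  exact Fintype.sum_equiv (Equiv.piEquivPiSubtypeProd (fun i => i ∈ S) (fun i => Fin (dim i))).symm
    _ _ (fun p => rfl)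

lemma ssa_set {ι : Type*} [Fintype ι] [DecidableEq ι] {dim : ι → ℕ}
    {ρ : Matrix ((i : ι) → Fin (dim i)) ((i : ι) → Fin (dim i)) ℂ} (h : ρ.PosSemidef)
    (htr : ρ.trace = 1) {A B C : Finset ι} (hAB : Disjoint A B) (hAC : Disjoint A C)
    (hBC : Disjoint B C) :
    mEnt ρ (A ∪ (B ∪ C)) + mEnt ρ B ≤ mEnt ρ (A ∪ B) + mEnt ρ (B ∪ C) := by
  have hABC : Disjoint A (B ∪ C) := Finset.disjoint_union_right.2 ⟨hAB, hAC⟩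
  have hABC2 : Disjoint (A ∪ B) C := Finset.disjoint_union_left.2 ⟨hAC, hBC⟩
  let gBC := glueEquiv (dim := dim) (rfl : B ∪ C = B ∪ C) hBC
  let gAB := glueEquiv (dim := dim) (rfl : A ∪ B = A ∪ B) hAB
  let g := (Equiv.prodCongr (Equiv.refl ((i : {j : ι // j ∈ A}) → Fin (dim i.1))) gBC).trans
    (glueEquiv (dim := dim) (rfl : A ∪ (B ∪ C) = A ∪ (B ∪ C)) hABC)
  have hne : Nonempty ((i : {j : ι // j ∈ C}) → Fin (dim i.1)) := by
    by_contra hh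
    rw [not_nonempty_iff] at hh
    have := marginal_trace ρ C
    rw [htr] at this
    simp [Matrix.trace] at this
  have hM := (marginal_posSemidef h (A ∪ (B ∪ C))).submatrix g
  have key := ssa_prod hM
  have e1 : ptr (Equiv.prodComm ((i : {j : ι // j ∈ A}) → Fin (dim i.1)) _)
      ((marginal ρ (A ∪ (B ∪ C))).submatrix g g) = (marginal ρ (B ∪ C)).submatrix gBC gBC := by
    ext x y
    simp only [ptr, Matrix.submatrix_apply]
    rw [← marginal_glue ρ (Finset.union_comm (B ∪ C) A) hABC.symm]
    refine Finset.sum_congr rfl fun t _ => ?_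
    have : ∀ x, g ((Equiv.prodComm ((i : {j : ι // j ∈ A}) → Fin (dim i.1)) _).symm (x, t))
        = glue (Finset.union_comm (B ∪ C) A) (gBC x) t := by
      intro x
      change glue rfl t (gBC x) = _
      ext i
      simp only [glue]
      by_cases h1 : i.1 ∈ A
      · have h2 : i.1 ∉ B ∪ C := Finset.disjoint_left.1 hABC h1
        simp only [h1, h2, dif_pos, dif_neg, not_false_eq_true]
      · have h2 : i.1 ∈ B ∪ C := (Finset.mem_union.1 i.2).resolve_left h1
        simp only [h1, h2, dif_pos, dif_neg, not_false_eq_true]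
    rw [this, this]
  have e2 : ptr (Equiv.refl _) ((marginal ρ (B ∪ C)).submatrix gBC gBC) = marginal ρ B := by
    ext x y
    rw [← marginal_glue ρ (rfl : B ∪ C = B ∪ C) hBC]
    rfl
  have e3 : ptr (Equiv.prodAssoc _ _ _).symm ((marginal ρ (A ∪ (B ∪ C))).submatrix g g)
      = (marginal ρ (A ∪ B)).submatrix gAB gAB := by
    ext x y
    simp only [ptr, Matrix.submatrix_apply]
    rw [← marginal_glue ρ (Finset.union_assoc A B C) hABC2]
    refine Finset.sum_congr rfl fun t _ => ?_
    have : ∀ x, g ((Equiv.prodAssoc _ _ _).symm.symm (x, t))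
        = glue (Finset.union_assoc A B C) (gAB x) t := by
      intro x
      change glue rfl x.1 (glue rfl x.2 t) = glue _ (glue rfl x.1 x.2) t
      ext i
      simp only [glue]
      by_cases h1 : i.1 ∈ A
      · have h2 : i.1 ∈ A ∪ B := Finset.mem_union_left _ h1
        simp only [h1, h2, dif_pos]
      · by_cases h3 : i.1 ∈ B
        · have h2 : i.1 ∈ A ∪ B := Finset.mem_union_right _ h3
          simp only [h1, h2, h3, dif_pos, dif_neg, not_false_eq_true]
        · have h2 : i.1 ∉ A ∪ B := fun h => (Finset.mem_union.1 h).elim h1 h3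
          simp only [h1, h2, h3, dif_neg, not_false_eq_true]
    rw [this, this]
  rw [e1, e2, e3, vnEntropy_submatrix _ (marginal_posSemidef h _).1,
    vnEntropy_submatrix _ (marginal_posSemidef h _).1,
    vnEntropy_submatrix _ (marginal_posSemidef h _).1] at key
  exact key

lemma card_part {ι : Type*} {dim : ι → ℕ} (S : Finset ι)
    [inst : Fintype ((i : {j : ι // j ∈ S}) → Fin (dim i.1))] :
    Fintype.card ((i : {j : ι // j ∈ S}) → Fin (dim i.1)) = ∏ i ∈ S, dim i := by
  rw [← Nat.card_eq_fintype_card, Nat.card_pi]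
  simp only [Nat.card_eq_fintype_card, Fintype.card_fin]
  exact Finset.prod_coe_sort S dim

lemma mEnt_submod {ι : Type*} [Fintype ι] [DecidableEq ι] {dim : ι → ℕ}
    {ρ : Matrix ((i : ι) → Fin (dim i)) ((i : ι) → Fin (dim i)) ℂ} (h : ρ.PosSemidef)
    (htr : ρ.trace = 1) (S T : Finset ι) :
    mEnt ρ (S ∪ T) + mEnt ρ (S ∩ T) ≤ mEnt ρ S + mEnt ρ T := by
  have := ssa_set h htr (A := S \ T) (B := S ∩ T) (C := T \ S)
    (by rw [Finset.disjoint_left]; intro a; simp; tauto)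
    (by rw [Finset.disjoint_left]; intro a; simp; tauto)
    (by rw [Finset.disjoint_left]; intro a; simp; tauto)
  rw [show S \ T ∪ (S ∩ T ∪ T \ S) = S ∪ T by ext a; simp; tauto,
    show S \ T ∪ S ∩ T = S by ext a; simp; tauto,
    show S ∩ T ∪ T \ S = T by ext a; simp; tauto] at this
  exact this

lemma mEnt_empty {ι : Type*} [Fintype ι] [DecidableEq ι] {dim : ι → ℕ}
    {ρ : Matrix ((i : ι) → Fin (dim i)) ((i : ι) → Fin (dim i)) ℂ} 
    (htr : ρ.trace = 1) : mEnt ρ ∅ = 0 := by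
  have ht := marginal_trace ρ ∅
  rw [htr] at ht
  have : marginal ρ ∅ = ((1 : ℝ) : ℂ) • 1 := by
    ext x y
    rw [Subsingleton.elim y x]
    rw [Matrix.trace, Fintype.sum_subsingleton _ x] at ht
    simpa using ht
  rw [mEnt, this, vnEntropy_scalar]
  simp

/-- Han's inequality for one set -/
lemma han_one {ι : Type*} [DecidableEq ι] (s : Finset ι → ℝ) (h0 : s ∅ = 0)
    (hs : ∀ S T, s (S ∪ T) + s (S ∩ T) ≤ s S + s T) (I : Finset ι) (P : Finset ι) (hP : P ⊆ I) :
    ∑ i ∈ P, (s I - s (I.erase i)) ≤ s P := by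
  induction P using Finset.induction_on with
  | empty => simp [h0]
  | insert a P ha ih =>
    rw [Finset.sum_insert ha]
    have h1 := ih ((Finset.subset_insert a P).trans hP)
    have h2 := hs (insert a P) (I.erase a)
    have haI : a ∈ I := hP (Finset.mem_insert_self a P)
    have hPI : P ⊆ I := (Finset.subset_insert a P).trans hP
    rw [show insert a P ∪ I.erase a = I by
        ext x
        have := @hPI x
        by_cases hx : x = a
        · simp [hx, haI]
        · simp [hx]; exact this,
      show insert a P ∩ I.erase a = P by
        ext x
        have := @hPI x
        by_cases hx : x = a
        · simp [hx, ha]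
        · simp [hx]; exact this] at h2
    linarith

lemma han_count {n k : ℕ} (s : Finset (Fin n) → ℝ) :
    ∑ I ∈ Finset.powersetCard (k + 1) (Finset.univ : Finset (Fin n)), ∑ i ∈ I, s (I.erase i)
      = ((n : ℝ) - k) * ∑ J ∈ Finset.powersetCard k (Finset.univ : Finset (Fin n)), s J := by
  have : ((n : ℝ) - k) * ∑ J ∈ Finset.powersetCard k (Finset.univ : Finset (Fin n)), s J
      = ∑ J ∈ Finset.powersetCard k (Finset.univ : Finset (Fin n)), ∑ i ∈ Jᶜ, s J := by
    rw [Finset.mul_sum]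
    refine Finset.sum_congr rfl fun J hJ => ?_
    have hc := (Finset.mem_powersetCard.1 hJ).2
    have hle : k ≤ n := by
      rw [← hc]; simpa using Finset.card_le_univ J
    rw [Finset.sum_const, Finset.card_compl, hc, Fintype.card_fin, nsmul_eq_mul, Nat.cast_sub hle]
  rw [this, Finset.sum_sigma', Finset.sum_sigma']
  refine Finset.sum_bij' (fun p _ => ⟨p.1.erase p.2, p.2⟩) (fun p _ => ⟨insert p.2 p.1, p.2⟩)
    ?_ ?_ ?_ ?_ ?_
  · rintro ⟨I, i⟩ h
    simp only [Finset.mem_sigma, Finset.mem_powersetCard] at h ⊢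
    simp [Finset.card_erase_of_mem h.2, h.1.2]
  · rintro ⟨J, i⟩ h
    simp only [Finset.mem_sigma, Finset.mem_powersetCard, Finset.mem_compl] at h ⊢
    simp [Finset.card_insert_of_notMem h.2, h.1.2]
  · rintro ⟨I, i⟩ h
    simp only [Finset.mem_sigma, Finset.mem_powersetCard] at h ⊢
    simp [Finset.insert_erase h.2]
  · rintro ⟨J, i⟩ h
    simp only [Finset.mem_sigma, Finset.mem_powersetCard, Finset.mem_compl] at h ⊢
    simp [Finset.erase_insert h.2]
  · rintro ⟨I, i⟩ h
    rfl

lemma han_step {n k : ℕ} (s : Finset (Fin n) → ℝ) (h0 : s ∅ = 0)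
    (hs : ∀ S T, s (S ∪ T) + s (S ∩ T) ≤ s S + s T) :
    (k : ℝ) * ∑ I ∈ Finset.powersetCard (k + 1) (Finset.univ : Finset (Fin n)), s I
      ≤ ((n : ℝ) - k) * ∑ J ∈ Finset.powersetCard k (Finset.univ : Finset (Fin n)), s J := by
  rw [← han_count, Finset.mul_sum]
  refine Finset.sum_le_sum fun I hI => ?_
  have h := han_one s h0 hs I I subset_rfl
  rw [Finset.sum_sub_distrib, Finset.sum_const, (Finset.mem_powersetCard.1 hI).2, nsmul_eq_mul] at h
  push_cast at h
  linarith

/-- average over subsets of size k -/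
noncomputable def avg {n : ℕ} (s : Finset (Fin n) → ℝ) (k : ℕ) : ℝ :=
  (∑ J ∈ Finset.powersetCard k (Finset.univ : Finset (Fin n)), s J) / (n.choose k : ℝ)

lemma avg_step {n k : ℕ} (s : Finset (Fin n) → ℝ) (h0 : s ∅ = 0)
    (hs : ∀ S T, s (S ∪ T) + s (S ∩ T) ≤ s S + s T) (hk : k + 1 ≤ n) :
    (k : ℝ) * avg s (k + 1) ≤ (k + 1) * avg s k := by
  have h := han_step (k := k) s h0 hs
  unfold avg
  have hc1 : (0 : ℝ) < n.choose (k + 1) := by exact_mod_cast Nat.choose_pos hk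
  have hc2 : (0 : ℝ) < n.choose k := by exact_mod_cast Nat.choose_pos (by omega)
  have e : (n.choose (k + 1) : ℝ) * (k + 1) = n.choose k * ((n : ℝ) - k) := by
    have := Nat.choose_succ_right_eq n k
    rw [← Nat.cast_sub (by omega : k ≤ n)]
    exact_mod_cast this
  generalize ∑ J ∈ Finset.powersetCard k (Finset.univ : Finset (Fin n)), s J = x at *
  generalize ∑ J ∈ Finset.powersetCard (k + 1) (Finset.univ : Finset (Fin n)), s J = y at *
  rw [← mul_div_assoc, ← mul_div_assoc, div_le_div_iff₀ hc1 hc2]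
  calc (k : ℝ) * y * n.choose k ≤ ((n : ℝ) - k) * x * n.choose k :=
        mul_le_mul_of_nonneg_right h hc2.le
    _ = (n.choose k * ((n : ℝ) - k)) * x := by ring
    _ = _ := by rw [← e]; ring

lemma avg_mono {n t : ℕ} (s : Finset (Fin n) → ℝ) (h0 : s ∅ = 0)
    (hs : ∀ S T, s (S ∪ T) + s (S ∩ T) ≤ s S + s T) (ht : 1 ≤ t) (m : ℕ) (htm : t ≤ m)
    (hm : m ≤ n) : avg s m ≤ m * (avg s t / t) := by
  induction m, htm using Nat.le_induction with
  | base =>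
    have : (0 : ℝ) < t := by exact_mod_cast ht
    rw [mul_div_cancel₀ _ this.ne']
  | succ k hk ih =>
    have h1 := ih (by omega)
    have h2 := avg_step s h0 hs hm
    have hkp : (0 : ℝ) < k := by exact_mod_cast (by omega : 0 < k)
    push_cast
    refine le_of_mul_le_mul_left ?_ hkp
    calc (k : ℝ) * avg s (k + 1) ≤ (k + 1) * avg s k := h2
      _ ≤ (k + 1) * (k * (avg s t / t)) := mul_le_mul_of_nonneg_left h1 (by positivity)
      _ = _ := by ring

/-- entanglement-assisted quantum Singleton bound, case `2(d-1) < n`: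
`log K ≤ (n-2d+2) σ̄ + ℓ ≤ (n-2d+2) log q + ℓ`.
Systems: `R = Sum.inr 0`, `A_f = Sum.inr 1`, `B_in = Sum.inr 2`. -/
theorem ea_singleton_small_distance
    (n d q K : ℕ) (hq : 2 ≤ q) (hK : 1 ≤ K) (hd : 2 ≤ d) (hdn : 2 * (d - 1) < n)
    (dim : Fin n ⊕ Fin 3 → ℕ)
    (hdimX : ∀ i : Fin n, dim (Sum.inl i) = q)
    (hdimR : dim (Sum.inr 0) = K)
    (ψ : Matrix ((i : Fin n ⊕ Fin 3) → Fin (dim i))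
                ((i : Fin n ⊕ Fin 3) → Fin (dim i)) ℂ)
    (hpsd : ψ.PosSemidef) (htr : ψ.trace = 1) (hpure : ψ.rank = 1)
    (hmaxmix : marginal ψ ({Sum.inr 0} : Finset (Fin n ⊕ Fin 3)) = (K : ℂ)⁻¹ • 1)
    (hdec : ∀ I J : Finset (Fin n), Disjoint I J → I ∪ J = Finset.univ →
      I.card = n - d + 1 → J.card = d - 1 →
      mEnt ψ (I.image Sum.inl ∪ ({Sum.inr 2} : Finset (Fin n ⊕ Fin 3))) =
        mEnt ψ ({Sum.inr 0} : Finset (Fin n ⊕ Fin 3)) + mEnt ψ ({Sum.inr 1} : Finset (Fin n ⊕ Fin 3)) + mEnt ψ (J.image Sum.inl)) :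
    Real.log K ≤ ((n : ℝ) - 2 * d + 2) *
        ((1 / ((d : ℝ) - 1)) * ((∑ J ∈ Finset.powersetCard (d - 1) (Finset.univ : Finset (Fin n)),
            mEnt ψ (J.image Sum.inl)) / (n.choose (d - 1) : ℝ))) + (mEnt ψ ({Sum.inr 2} : Finset (Fin n ⊕ Fin 3)) - mEnt ψ ({Sum.inr 1} : Finset (Fin n ⊕ Fin 3)))
    ∧ ((n : ℝ) - 2 * d + 2) * ((1 / ((d : ℝ) - 1)) * ((∑ J ∈ Finset.powersetCard (d - 1) (Finset.univ : Finset (Fin n)),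
            mEnt ψ (J.image Sum.inl)) / (n.choose (d - 1) : ℝ))) + (mEnt ψ ({Sum.inr 2} : Finset (Fin n ⊕ Fin 3)) - mEnt ψ ({Sum.inr 1} : Finset (Fin n ⊕ Fin 3)))
      ≤ ((n : ℝ) - 2 * d + 2) * Real.log q + (mEnt ψ ({Sum.inr 2} : Finset (Fin n ⊕ Fin 3)) - mEnt ψ ({Sum.inr 1} : Finset (Fin n ⊕ Fin 3))) := by
  obtain ⟨t, rfl⟩ : ∃ t, d = t + 1 := ⟨d - 1, by omega⟩
  simp only [Nat.add_sub_cancel] at hdn hdec ⊢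
  have ht : 1 ≤ t := by omega
  have htp : (0 : ℝ) < t := by exact_mod_cast ht
  set s : Finset (Fin n) → ℝ := fun J => mEnt ψ (J.image Sum.inl) with hsdef
  have h0 : s ∅ = 0 := by
    simp only [hsdef, Finset.image_empty]
    exact mEnt_empty htr
  have hs : ∀ S T, s (S ∪ T) + s (S ∩ T) ≤ s S + s T := by
    intro S T
    simp only [hsdef]
    rw [Finset.image_union, Finset.image_inter _ _ Sum.inl_injective]
    exact mEnt_submod hpsd htr _ _
  have hR : mEnt ψ ({Sum.inr 0} : Finset (Fin n ⊕ Fin 3)) = Real.log K := by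
    rw [mEnt, hmaxmix, show ((K : ℂ)⁻¹) = (((K : ℝ)⁻¹ : ℝ) : ℂ) by push_cast; rfl, vnEntropy_scalar]
    rw [card_part, Finset.prod_singleton, hdimR, Real.log_inv]
    have : (0 : ℝ) < K := by exact_mod_cast hK
    field_simp
  set B := mEnt ψ ({Sum.inr 2} : Finset (Fin n ⊕ Fin 3))
  set A := mEnt ψ ({Sum.inr 1} : Finset (Fin n ⊕ Fin 3))
  have hcpos : (0 : ℝ) < n.choose t := by exact_mod_cast Nat.choose_pos (by omega)
  have hJ : ∀ J ∈ Finset.powersetCard t (Finset.univ : Finset (Fin n)),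
      Real.log K + A + s J ≤ s Jᶜ + B := by
    intro J hJ
    have hc := (Finset.mem_powersetCard.1 hJ).2
    have h1 := hdec Jᶜ J disjoint_compl_left (by rw [Finset.union_comm]; exact Finset.union_compl J)
      (by rw [Finset.card_compl, hc, Fintype.card_fin]; omega) hc
    rw [hR] at h1
    have h2 := mEnt_submod hpsd htr (Jᶜ.image Sum.inl) ({Sum.inr 2} : Finset (Fin n ⊕ Fin 3))
    rw [show (Jᶜ.image Sum.inl) ∩ ({Sum.inr 2} : Finset (Fin n ⊕ Fin 3)) = ∅ by
      ext x; simp, mEnt_empty htr] at h2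
    change _ ≤ s Jᶜ + B at h2
    change _ = Real.log K + A + s J at h1
    linarith
  have hsum := Finset.sum_le_sum hJ
  have hcomp : ∑ J ∈ Finset.powersetCard t (Finset.univ : Finset (Fin n)), s Jᶜ
      = ∑ I ∈ Finset.powersetCard (n - t) (Finset.univ : Finset (Fin n)), s I := by
    refine Finset.sum_bij' (fun J _ => Jᶜ) (fun J _ => Jᶜ) ?_ ?_ ?_ ?_ ?_
    · intro J hJ
      simp only [Finset.mem_powersetCard] at hJ ⊢
      simp [Finset.card_compl, hJ.2]
    · intro J hJ
      simp only [Finset.mem_powersetCard] at hJ ⊢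
      simp [Finset.card_compl, hJ.2]; omega
    · simp
    · simp
    · simp
  rw [Finset.sum_add_distrib, Finset.sum_add_distrib, Finset.sum_add_distrib, hcomp, Finset.sum_const, Finset.sum_const, Finset.sum_const,
    Finset.card_powersetCard, Finset.card_univ, Fintype.card_fin, nsmul_eq_mul, nsmul_eq_mul,
    nsmul_eq_mul] at hsum
  have hav : Real.log K + A + avg s t ≤ avg s (n - t) + B := by
    unfold avg
    rw [Nat.choose_symm (by omega : t ≤ n)]
    refine le_of_mul_le_mul_left ?_ hcpos
    rw [mul_add, mul_add, mul_add, mul_div_cancel₀ _ hcpos.ne', mul_div_cancel₀ _ hcpos.ne']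
    exact hsum
  have hm := avg_mono s h0 hs ht (n - t) (by omega) (by omega)
  rw [Nat.cast_sub (by omega : t ≤ n)] at hm
  have hfold : (∑ J ∈ Finset.powersetCard t (Finset.univ : Finset (Fin n)),
      mEnt ψ (J.image Sum.inl)) / (n.choose t : ℝ) = avg s t := rfl
  rw [hfold]
  have he : (1 / (((t + 1 : ℕ) : ℝ) - 1)) * avg s t = avg s t / t := by
    push_cast
    rw [add_sub_cancel_right]
    ring
  have hcoef : (n : ℝ) - 2 * ((t + 1 : ℕ) : ℝ) + 2 = n - 2 * t := by push_cast; ring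
  rw [he, hcoef]
  have hta : avg s t = t * (avg s t / t) := by field_simp
  constructor
  · have : ((n : ℝ) - 2 * t) * (avg s t / t) = (n - t) * (avg s t / t) - t * (avg s t / t) := by ring
    rw [this]
    linarith
  · have hpos : (0 : ℝ) ≤ (n : ℝ) - 2 * t := by
      have : ((2 * t : ℕ) : ℝ) ≤ n := by exact_mod_cast hdn.le
      push_cast at this
      linarith
    have hb : avg s t / t ≤ Real.log q := by
      rw [div_le_iff₀ htp]
      unfold avg
      rw [div_le_iff₀ hcpos]
      have hle : ∀ J ∈ Finset.powersetCard t (Finset.univ : Finset (Fin n)), s J ≤ t * Real.log q := by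
        intro J hJ
        have hc := (Finset.mem_powersetCard.1 hJ).2
        have h1 := vnEntropy_le_log (marginal_posSemidef hpsd (J.image Sum.inl))
          (by rw [marginal_trace, htr])
        rw [card_part, Finset.prod_image (fun _ _ _ _ h => Sum.inl_injective h)] at h1
        simp only [hdimX, Finset.prod_const, hc] at h1
        push_cast at h1
        rw [Real.log_pow] at h1
        exact h1
      refine (Finset.sum_le_sum hle).trans ?_
      rw [Finset.sum_const, Finset.card_powersetCard, Finset.card_univ, Fintype.card_fin,
        nsmul_eq_mul]
      apply le_of_eq
      ring
    have := mul_le_mul_of_nonneg_left hb hpos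
    linarith
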